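/- (Equivalent characterizations of gaussian extremizers.) Fix a datum (c,d,B) and self-adjoint positive-definite operators U_j on E^j (1≤j≤m) and V_i on E_i (1≤i≤k), and set Θ := ⊕_{i=1}^k c_i V_i − Σ_{j=1}^m d_j Λ_c B_j* U_j B_j Λ_c (a self-adjoint operator on E_0). The following are equivalent: (i) (U_j)_{1≤j≤m}, (V_i)_{1≤i≤k} is a global maximizer of Σ_{j=1}^m d_j log det U_j − Σ_{i=1}^k c_i log det V_i subject to Θ ≥ 0; (ii) it is a local maximizer of the same constrained problem; (iii) there exists Π ∈ Π(V_1^{−1},…,V_k^{−1}) such that U_j^{−1} = B_j Λ_c Π Λ_c B_j* for all 1≤j≤m, Θ ≥ 0, and Θx = 0 for every x ∈ Π E_0; (iv) the scaling condition holds, there exists Π ∈ Π(V_1^{−1},…,V_k^{−1}) with U_j^{−1} = B_j Λ_c Π Λ_c B_j* for all 1≤j≤m, and Θ ≥ 0; (v) the scaling condition holds, and there exists Π ∈ Π(V_1^{−1},…,V_k^{−1}) with U_j^{−1} ≥ B_j Λ_c Π Λ_c B_j* for all 1≤j≤m, Θ ≥ 0, and Π^{1/2} Θ Π^{1/2} =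 0. -/

import Mathlib

open MeasureTheory LinearMap
open scoped RealInnerProductSpace BigOperators NNReal ENNReal

noncomputable section

namespace FRBL

/-- A positive semidefinite (self-adjoint) operator on a real inner product space. -/
def PosSemidef {G : Type*} [NormedAddCommGroup G] [InnerProductSpace ℝ G]
    (A : G →ₗ[ℝ] G) : Prop :=
  A.IsSymmetric ∧ ∀ x : G, 0 ≤ ⟪A x, x⟫

/-- A positive definite (self-adjoint) operator on a real inner product space. -/
def PosDef {G : Type*} [NormedAddCommGroup G] [InnerProductSpace ℝ G]
    (A : G →ₗ[ℝ] G) : Prop :=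
  A.IsSymmetric ∧ ∀ x : G, x ≠ 0 → 0 < ⟪A x, x⟫

variable {k m : ℕ}
  (E : Fin k → Type*) (F : Fin m → Type*)
  [∀ i, NormedAddCommGroup (E i)] [∀ i, InnerProductSpace ℝ (E i)]
  [∀ i, FiniteDimensional ℝ (E i)]
  [∀ i, MeasurableSpace (E i)] [∀ i, BorelSpace (E i)]
  [∀ j, NormedAddCommGroup (F j)] [∀ j, InnerProductSpace ℝ (F j)]
  [∀ j, FiniteDimensional ℝ (F j)]
  [∀ j, MeasurableSpace (F j)] [∀ j, BorelSpace (F j)]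
  (c : Fin k → ℝ) (d : Fin m → ℝ)
  (B : ∀ i j, E i →ₗ[ℝ] F j)

/-- The pointwise domination hypothesis of the forward-reverse Brascamp-Lieb inequality. -/
def Hyp (f : ∀ i, E i → ℝ≥0) (g : ∀ j, F j → ℝ≥0) : Prop :=
  ∀ x : ∀ i, E i,
    (∏ i, f i (x i) ^ c i) ≤ ∏ j, g j (∑ i, c i • B i j (x i)) ^ d j

/-- `D₀` is an admissible constant for the forward-reverse Brascamp-Lieb inequality. -/
def IsBound (D₀ : ℝ) : Prop :=
  ∀ (f : ∀ i, E i → ℝ≥0) (g : ∀ j, F j → ℝ≥0),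
    (∀ i, Measurable (f i)) → (∀ j, Measurable (g j)) →
    Hyp E F c d B f g →
    (∏ i, (∫⁻ x, (f i x : ℝ≥0∞)) ^ c i) ≤
      ENNReal.ofReal (Real.exp D₀) * ∏ j, (∫⁻ y, (g j y : ℝ≥0∞)) ^ d j

/-- The best constant `D(c,d,B)` in the forward-reverse Brascamp-Lieb inequality. -/
def D : EReal :=
  sInf {x : EReal | ∃ D₀ : ℝ, x = (D₀ : EReal) ∧ IsBound E F c d B D₀}

/-- The gaussian constraint `Λ_c B* U_d B Λ_c ≤ V_c`, written via quadratic forms. -/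
def GaussCon (V : ∀ i, E i →ₗ[ℝ] E i) (U : ∀ j, F j →ₗ[ℝ] F j) : Prop :=
  ∀ x : ∀ i, E i,
    (∑ j, d j * ⟪U j (∑ i, c i • B i j (x i)), ∑ i, c i • B i j (x i)⟫) ≤
      ∑ i, c i * ⟪V i (x i), x i⟫

/-- The objective functional in the definition of the gaussian constant. -/
def gaussObj (V : ∀ i, E i →ₗ[ℝ] E i) (U : ∀ j, F j →ₗ[ℝ] F j) : ℝ :=
  (∑ j, d j * Real.log (LinearMap.det (U j)) -
    ∑ i, c i * Real.log (LinearMap.det (V i))) / 2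

/-- The gaussian best constant `D_g(c,d,B)`. -/
def Dg : EReal :=
  sSup {x : EReal | ∃ (V : ∀ i, E i →ₗ[ℝ] E i) (U : ∀ j, F j →ₗ[ℝ] F j),
    (∀ i, PosDef (V i)) ∧ (∀ j, PosDef (U j)) ∧ GaussCon E F c d B V U ∧
    x = (gaussObj E F c d V U : EReal)}

/-- The datum `(c,d,B)` is gaussian-extremizable: the supremum defining `D_g` is
finite and attained. -/
def GaussExt : Prop :=
  ∃ (V : ∀ i, E i →ₗ[ℝ] E i) (U : ∀ j, F j →ₗ[ℝ] F j),
    (∀ i, PosDef (V i)) ∧ (∀ j, PosDef (U j)) ∧ GaussCon E F c d B V U ∧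
    Dg E F c d B = (gaussObj E F c d V U : EReal)

/-- The canonical linear equivalence between `E₀ = ⊕ᵢ Eᵢ` (as `PiLp 2`) and the pi type. -/
def toPi : PiLp 2 E ≃ₗ[ℝ] ∀ i, E i := WithLp.linearEquiv 2 ℝ (∀ i, E i)

/-- Orthogonal projection `π_{E_i} : E₀ → E_i`. -/
def projL (i : Fin k) : PiLp 2 E →ₗ[ℝ] E i := (LinearMap.proj i).comp (toPi E).toLinearMap

/-- The embedding `E_i → E₀`. -/
def singleL (i : Fin k) : E i →ₗ[ℝ] PiLp 2 E :=
  (toPi E).symm.toLinearMap.comp (LinearMap.single ℝ E i)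

/-- The map `B_j : E₀ → E^j`, `x ↦ ∑ᵢ B_{ij} π_{E_i} x`. -/
def Bop (j : Fin m) : PiLp 2 E →ₗ[ℝ] F j := ∑ i, (B i j).comp (projL E i)

/-- `Λ_c = ⊕ᵢ cᵢ id_{E_i}` as an operator on `E₀`. -/
def Lam : PiLp 2 E →ₗ[ℝ] PiLp 2 E := ∑ i, c i • (singleL E i).comp (projL E i)

/-- The set `Π(A_1, …, A_k)` of positive semidefinite "couplings". -/
def Coupling (A : ∀ i, E i →ₗ[ℝ] E i) : Set (PiLp 2 E →ₗ[ℝ] PiLp 2 E) :=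
  {P | PosSemidef P ∧ ∀ (i : Fin k) (v : E i),
    ⟪P (singleL E i v), singleL E i v⟫ = ⟪A i v, v⟫}

/-- The scaling condition `∑ᵢ cᵢ dim Eᵢ = ∑ⱼ dⱼ dim E^j`. -/
def ScalingCond : Prop :=
  ∑ i, c i * (Module.finrank ℝ (E i) : ℝ) = ∑ j, d j * (Module.finrank ℝ (F j) : ℝ)

/-- A subspace `T ⊆ E₀` is of product form, i.e. `T = ⊕ᵢ π_{E_i} T`. -/
def ProductForm (T : Submodule ℝ (PiLp 2 E)) : Prop :=
  ∀ x ∈ T, ∀ i, singleL E i (projL E i x) ∈ T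

/-- The dimension condition over product-form subspaces. -/
def DimCond : Prop :=
  ∀ T : Submodule ℝ (PiLp 2 E), ProductForm E T →
    (∑ i, c i * (Module.finrank ℝ (T.map (projL E i)) : ℝ)) ≤
      ∑ j, d j * (Module.finrank ℝ (T.map (Bop E F B j)) : ℝ)

/-- A critical subspace. -/
def IsCritical (T : Submodule ℝ (PiLp 2 E)) : Prop :=
  T ≠ ⊥ ∧ T ≠ ⊤ ∧ ProductForm E T ∧
    ∑ i, c i * (Module.finrank ℝ (T.map (projL E i)) : ℝ) =
      ∑ j, d j * (Module.finrank ℝ (T.map (Bop E F B j)) : ℝ)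

/-- The datum is simple if it has no critical subspace. -/
def Simple : Prop := ∀ T : Submodule ℝ (PiLp 2 E), ¬ IsCritical E F c d B T

end FRBL

namespace FRBL

/-- `log det` with value `−∞` on operators with non-positive determinant
(in particular on singular positive-semidefinite operators). -/
def elogdet {G : Type*} [AddCommGroup G] [Module ℝ G] (A : G →ₗ[ℝ] G) : EReal :=
  if 0 < LinearMap.det A then ((Real.log (LinearMap.det A) : ℝ) : EReal) else ⊥

variable {k m : ℕ}
  (E : Fin k → Type*) (F : Fin m → Type*)
  [∀ i, NormedAddCommGroup (E i)] [∀ i, InnerProductSpace ℝ (E i)]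
  [∀ i, FiniteDimensional ℝ (E i)]
  [∀ j, NormedAddCommGroup (F j)] [∀ j, InnerProductSpace ℝ (F j)]
  [∀ j, FiniteDimensional ℝ (F j)]
  (c : Fin k → ℝ) (d : Fin m → ℝ)
  (B : ∀ i j, E i →ₗ[ℝ] F j)

/-- The map `Q_j := B_j Λ_c : E₀ → E^j`. -/
def BLam (j : Fin m) : PiLp 2 E →ₗ[ℝ] F j := (Bop E F B j).comp (Lam E c)

/-- The optimality condition of Theorem 2 (structure of gaussian extremizers):
each `B_j Λ_c Π Λ_c B_j*` is invertible and
`∑ⱼ dⱼ Λ_c B_j* (B_j Λ_c Π Λ_c B_j*)⁻¹ B_j Λ_c ≤ V_c` in the quadratic-form sense. -/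
def ExtCond (V : ∀ i, E i →ₗ[ℝ] E i) (P : PiLp 2 E →ₗ[ℝ] PiLp 2 E) : Prop :=
  (∀ j, IsUnit ((BLam E F c B j) ∘ₗ P ∘ₗ LinearMap.adjoint (BLam E F c B j))) ∧
  ∀ x : PiLp 2 E,
    (∑ j, d j * ⟪Ring.inverse ((BLam E F c B j) ∘ₗ P ∘ₗ LinearMap.adjoint (BLam E F c B j))
        (BLam E F c B j x), BLam E F c B j x⟫) ≤
      ∑ i, c i * ⟪V i (projL E i x), projL E i x⟫

/-- A geometric datum. -/
def Geometric : Prop :=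
  ScalingCond E F c d ∧
  ∃ S ∈ Coupling E (fun i => (LinearMap.id : E i →ₗ[ℝ] E i)),
    (∀ j, (BLam E F c B j) ∘ₗ S ∘ₗ LinearMap.adjoint (BLam E F c B j) = LinearMap.id) ∧
    ∀ x : PiLp 2 E, (∑ j, d j * ⟪BLam E F c B j x, BLam E F c B j x⟫) ≤ ⟪Lam E c x, x⟫

/-- Equivalence of data: `B'_j = C_j⁻¹ B_j C⁻¹` for invertible `C, C_j`. -/
def EquivData (B' : ∀ i j, E i →ₗ[ℝ] F j) : Prop :=
  ∃ (C : PiLp 2 E ≃ₗ[ℝ] PiLp 2 E) (Cj : ∀ j, F j ≃ₗ[ℝ] F j),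
    ∀ j, Bop E F B' j =
      ((Cj j).symm.toLinearMap ∘ₗ Bop E F B j) ∘ₗ C.symm.toLinearMap

/-- `V_c = ⊕ᵢ cᵢ Vᵢ` as an operator on `E₀`. -/
def blockDiag (V : ∀ i, E i →ₗ[ℝ] E i) : PiLp 2 E →ₗ[ℝ] PiLp 2 E :=
  ∑ i, c i • ((singleL E i) ∘ₗ (V i)) ∘ₗ (projL E i)

/-- `Θ = V_c − ∑ⱼ dⱼ Λ_c B_j* U_j B_j Λ_c`. -/
def Theta (V : ∀ i, E i →ₗ[ℝ] E i) (U : ∀ j, F j →ₗ[ℝ] F j) :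
    PiLp 2 E →ₗ[ℝ] PiLp 2 E :=
  blockDiag E c V -
    ∑ j, d j • (LinearMap.adjoint (BLam E F c B j) ∘ₗ (U j)) ∘ₗ (BLam E F c B j)

end FRBL

namespace FRBL

/-- Borel structure on submodules (inherited from the ambient space). -/
instance subBorel {G : Type*} [AddCommGroup G] [Module ℝ G] [TopologicalSpace G]
    [MeasurableSpace G] [BorelSpace G] (T : Submodule ℝ G) : BorelSpace ↥T :=
  Subtype.borelSpace (T : Set G)

/-- The maximal dimension of a subspace on which the self-adjoint operator `Q` is positive
definite; by Sylvester's law of inertia this is the number of positive eigenvalues of `Q`,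
counted with multiplicity. -/
def posIndex {H : Type*} [NormedAddCommGroup H] [InnerProductSpace ℝ H]
    (Q : H →ₗ[ℝ] H) : ℕ :=
  sSup {r : ℕ | ∃ W : Submodule ℝ H,
    (∀ x ∈ W, x ≠ 0 → 0 < ⟪Q x, x⟫) ∧ Module.finrank ℝ W = r}

/-- The standard gaussian probability measure on a Euclidean space. -/
def stdGaussian (G : Type*) [NormedAddCommGroup G] [InnerProductSpace ℝ G]
    [FiniteDimensional ℝ G] [MeasurableSpace G] [BorelSpace G] :
    Measure G :=
  volume.withDensity fun x =>
    ENNReal.ofReal ((2 * Real.pi) ^ (-(Module.finrank ℝ G : ℝ) / 2) *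
      Real.exp (-‖x‖ ^ 2 / 2))

/-- `K_s = (|s|^{1/s} |s'|^{1/s'})^{1/2}`. -/
def Kconst (s s' : ℝ) : ℝ := Real.sqrt (|s| ^ (1 / s) * |s'| ^ (1 / s'))

variable {k m : ℕ}
  (E : Fin k → Type*) (F : Fin m → Type*)
  [∀ i, NormedAddCommGroup (E i)] [∀ i, InnerProductSpace ℝ (E i)]
  [∀ i, FiniteDimensional ℝ (E i)]
  [∀ j, NormedAddCommGroup (F j)] [∀ j, InnerProductSpace ℝ (F j)]
  [∀ j, FiniteDimensional ℝ (F j)]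
  (c : Fin k → ℝ) (d : Fin m → ℝ)
  (B : ∀ i j, E i →ₗ[ℝ] F j)

/-- The objective functional `∑ⱼ dⱼ log det Uⱼ − ∑ᵢ cᵢ log det Vᵢ`. -/
def objective (V : ∀ i, E i →ₗ[ℝ] E i) (U : ∀ j, F j →ₗ[ℝ] F j) : ℝ :=
  ∑ j, d j * Real.log (LinearMap.det (U j)) - ∑ i, c i * Real.log (LinearMap.det (V i))

/-- Feasibility for the optimization problem defining `D_g`: positive definiteness
together with the constraint `Θ ≥ 0`. -/
def Admissible (V : ∀ i, E i →ₗ[ℝ] E i) (U : ∀ j, F j →ₗ[ℝ] F j) : Prop :=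
  (∀ i, PosDef (V i)) ∧ (∀ j, PosDef (U j)) ∧ PosSemidef (Theta E F c d B V U)

/-- Global maximality in the optimization problem defining `D_g`. -/
def IsGlobalMax (V : ∀ i, E i →ₗ[ℝ] E i) (U : ∀ j, F j →ₗ[ℝ] F j) : Prop :=
  Admissible E F c d B V U ∧
    ∀ V' U', Admissible E F c d B V' U' →
      objective E F c d V' U' ≤ objective E F c d V U

/-- Local maximality in the optimization problem defining `D_g`. -/
def IsLocalMax (V : ∀ i, E i →ₗ[ℝ] E i) (U : ∀ j, F j →ₗ[ℝ] F j) : Prop :=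
  Admissible E F c d B V U ∧
    ∃ ε : ℝ, 0 < ε ∧
      ∀ V' U', Admissible E F c d B V' U' →
        (∀ i, ‖LinearMap.toContinuousLinearMap (V' i - V i)‖ < ε) →
        (∀ j, ‖LinearMap.toContinuousLinearMap (U' j - U j)‖ < ε) →
        objective E F c d V' U' ≤ objective E F c d V U

end FRBL

namespace FRBL

theorem isCompact_convexHull_of_isCompact {W : Type*} [NormedAddCommGroup W]
    [NormedSpace ℝ W] [FiniteDimensional ℝ W] {S : Set W} (hS : IsCompact S) :
    IsCompact (convexHull ℝ S) := by
  let T : ℕ → Set W := fun n => (fun p : (Fin n → ℝ) × (Fin n → W) => ∑ i, p.1 i • p.2 i) ''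
    (stdSimplex ℝ (Fin n) ×ˢ Set.univ.pi fun _ => S)
  have hT : ∀ n, IsCompact (T n) := fun n =>
    ((isCompact_stdSimplex ℝ (Fin n)).prod (isCompact_univ_pi fun _ => hS)).image (by fun_prop)
  have : convexHull ℝ S = ⋃ n ∈ Finset.range (Module.finrank ℝ W + 2), T n := by
    refine Set.Subset.antisymm (fun x hx => ?_) ?_
    · obtain ⟨ι, _, z, w, hz, hind, hw, hw1, hx⟩ := eq_pos_convex_span_of_mem_convexHull hx
      let e := Fintype.equivFin ι
      refine Set.mem_biUnion (x := Fintype.card ι) ?_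
        ⟨(fun i => w (e.symm i), fun i => z (e.symm i)), ⟨⟨fun i => (hw _).le, ?_⟩, ?_⟩, ?_⟩
      · have h1 := hind.card_le_finrank_succ
        have h2 := Submodule.finrank_le (vectorSpan ℝ (Set.range z))
        simp only [Finset.coe_range, Set.mem_Iio]
        omega
      · rw [← hw1]; exact e.symm.sum_comp w
      · exact fun i _ => hz ⟨_, rfl⟩
      · rw [← hx]; exact e.symm.sum_comp fun i => w i • z i
    · refine Set.iUnion₂_subset fun n _ => ?_
      rintro _ ⟨p, ⟨hp1, hp2⟩, rfl⟩
      exact (convex_convexHull ℝ S).sum_mem (fun i _ => hp1.1 i) hp1.2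
        fun i _ => subset_convexHull ℝ S (hp2 i (Set.mem_univ i))
  rw [this]
  exact (Finset.range _).isCompact_biUnion fun n _ => hT n

section Spectral

variable {G : Type*} [NormedAddCommGroup G] [InnerProductSpace ℝ G]

theorem exists_orthonormal_eigenbasis [FiniteDimensional ℝ G] {A : G →ₗ[ℝ] G}
    (hA : A.IsSymmetric) :
    ∃ (b : OrthonormalBasis (Fin (Module.finrank ℝ G)) ℝ G)
      (r : Fin (Module.finrank ℝ G) → ℝ), ∀ l, A (b l) = r l • b l :=
  ⟨hA.eigenvectorBasis rfl, hA.eigenvalues rfl, hA.apply_eigenvectorBasis rfl⟩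

theorem apply_eq_sum_of_eigenbasis {ι : Type*} [Fintype ι] {A : G →ₗ[ℝ] G}
    (b : OrthonormalBasis ι ℝ G) {r : ι → ℝ} (h : ∀ l, A (b l) = r l • b l) (x : G) :
    A x = ∑ l, (r l * ⟪b l, x⟫) • b l := by
  conv_lhs => rw [← b.sum_repr' x]
  simp [map_sum, h, smul_smul, mul_comm]

theorem det_of_eigenbasis {ι : Type*} [Fintype ι] {A : G →ₗ[ℝ] G}
    (b : OrthonormalBasis ι ℝ G) {r : ι → ℝ} (h : ∀ l, A (b l) = r l • b l) :
    LinearMap.det A = ∏ l, r l := by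
  classical
  rw [← LinearMap.det_toMatrix b.toBasis]
  have : LinearMap.toMatrix b.toBasis b.toBasis A = Matrix.diagonal r := by
    ext i j
    rw [LinearMap.toMatrix_apply]
    by_cases hij : i = j
    · subst hij; simp [h]
    · simp [h, hij, Matrix.diagonal_apply_ne]
  rw [this, Matrix.det_diagonal]

theorem PosDef.posSemidef {A : G →ₗ[ℝ] G} (hA : PosDef A) : PosSemidef A :=
  ⟨hA.1, fun x => by
    rcases eq_or_ne x 0 with rfl | hx
    · simp
    · exact (hA.2 x hx).le⟩

variable [FiniteDimensional ℝ G]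

theorem PosSemidef.exists_sqrt {A : G →ₗ[ℝ] G} (hA : PosSemidef A) :
    ∃ R : G →ₗ[ℝ] G, PosSemidef R ∧ R ∘ₗ R = A := by
  obtain ⟨b, r, hb⟩ := exists_orthonormal_eigenbasis hA.1
  have hr : ∀ l, 0 ≤ r l := fun l => by
    simpa [hb, inner_smul_left] using hA.2 (b l)
  let R : G →ₗ[ℝ] G := b.toBasis.constr ℝ fun l => √(r l) • b l
  have hR : ∀ l, R (b l) = √(r l) • b l := fun l => by
    rw [← b.coe_toBasis]
    exact b.toBasis.constr_basis ℝ _ l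
  have hRx := apply_eq_sum_of_eigenbasis b hR
  refine ⟨R, ⟨fun x y => ?_, fun x => ?_⟩, b.toBasis.ext fun l => ?_⟩
  · simp only [hRx, sum_inner, inner_sum, inner_smul_left, inner_smul_right]
    refine Finset.sum_congr rfl fun l _ => ?_
    simp [real_inner_comm x (b l)]; ring
  · simp only [hRx, sum_inner, inner_smul_left]
    refine Finset.sum_nonneg fun l _ => ?_
    simp only [conj_trivial]
    rw [mul_assoc]
    exact mul_nonneg (Real.sqrt_nonneg _) (mul_self_nonneg _)
  · simp [hR, hb, smul_smul, Real.mul_self_sqrt (hr l)]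

theorem PosSemidef.apply_eq_zero {A : G →ₗ[ℝ] G} (hA : PosSemidef A) {x : G}
    (hx : ⟪A x, x⟫ = 0) : A x = 0 := by
  obtain ⟨R, hR, rfl⟩ := hA.exists_sqrt
  have : R x = 0 := by
    rw [LinearMap.comp_apply, hR.1] at hx
    exact inner_self_eq_zero.mp hx
  simp [this]

theorem PosSemidef.eq_zero_of_trace_eq_zero {A : G →ₗ[ℝ] G} (hA : PosSemidef A)
    (h : LinearMap.trace ℝ G A = 0) : A = 0 := by
  let b := stdOrthonormalBasis ℝ G
  rw [LinearMap.trace_eq_sum_inner A b,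
    Finset.sum_eq_zero_iff_of_nonneg fun l _ => by
      rw [real_inner_comm]; exact hA.2 (b l)] at h
  refine b.toBasis.ext fun l => ?_
  have := h l (Finset.mem_univ l)
  rw [real_inner_comm] at this
  simpa using hA.apply_eq_zero this

theorem PosDef.isUnit {A : G →ₗ[ℝ] G} (hA : PosDef A) : IsUnit A := by
  rw [LinearMap.isUnit_iff_ker_eq_bot, LinearMap.ker_eq_bot']
  intro x hx
  by_contra h
  simpa [hx] using hA.2 x h

theorem PosDef.apply_inverse {A : G →ₗ[ℝ] G} (hA : PosDef A) (x : G) :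
    A (Ring.inverse A x) = x :=
  LinearMap.congr_fun (Ring.mul_inverse_cancel A hA.isUnit) x

theorem PosDef.inverse_apply {A : G →ₗ[ℝ] G} (hA : PosDef A) (x : G) :
    Ring.inverse A (A x) = x :=
  LinearMap.congr_fun (Ring.inverse_mul_cancel A hA.isUnit) x

theorem PosDef.isSymmetric_inverse {A : G →ₗ[ℝ] G} (hA : PosDef A) :
    (Ring.inverse A).IsSymmetric := fun x y => by
  conv_lhs => rw [← hA.apply_inverse y]
  rw [← hA.1, hA.apply_inverse]

theorem PosDef.det_pos {A : G →ₗ[ℝ] G} (hA : PosDef A) : 0 < LinearMap.det A := by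
  obtain ⟨b, r, hb⟩ := exists_orthonormal_eigenbasis hA.1
  rw [det_of_eigenbasis b hb]
  refine Finset.prod_pos fun l _ => ?_
  simpa [hb, inner_smul_left] using hA.2 (b l) (b.orthonormal.ne_zero l)

/-- Two symmetric linear maps, the first of them positive definite, are simultaneously
diagonalized by a family `u` with dual family `f`. -/
theorem PosDef.exists_simultaneous_diagonalization {A A' : G →ₗ[ℝ] G} (hA : PosDef A)
    (hA' : A'.IsSymmetric) :
    ∃ (u f : Fin (Module.finrank ℝ G) → G) (r : Fin (Module.finrank ℝ G) → ℝ),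
      (∀ x, A x = ∑ l, ⟪u l, x⟫ • u l) ∧
      (∀ x, A' x = ∑ l, (r l * ⟪u l, x⟫) • u l) ∧
      (∀ l p, ⟪u l, f p⟫ = if l = p then 1 else 0) ∧
      (∀ l, ⟪Ring.inverse A (u l), u l⟫ = 1) ∧
      (∀ s t : ℝ, LinearMap.det (s • A + t • A') = LinearMap.det A * ∏ l, (s + t * r l)) ∧
      LinearMap.trace ℝ G (A' ∘ₗ Ring.inverse A) = ∑ l, r l := by
  obtain ⟨R, hR, hRA⟩ := hA.posSemidef.exists_sqrt
  have hRA' : ∀ x, R (R x) = A x := LinearMap.congr_fun hRA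
  have hRpos : PosDef R := ⟨hR.1, fun x hx => (hR.2 x).lt_of_ne fun h => by
    have h0 := hR.apply_eq_zero h.symm
    have := hA.2 x hx
    rw [← hRA', h0] at this
    simp at this⟩
  set S : G →ₗ[ℝ] G := Ring.inverse R with hS
  have hRS : ∀ x, R (S x) = x := hRpos.apply_inverse
  have hSR : ∀ x, S (R x) = x := hRpos.inverse_apply
  have hSsymm : S.IsSymmetric := hRpos.isSymmetric_inverse
  have hinv : ∀ x, Ring.inverse A x = S (S x) := fun x => by
    rw [← hA.inverse_apply (S (S x)), ← hRA', hRS, hRS]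
  let W : G →ₗ[ℝ] G := S ∘ₗ A' ∘ₗ S
  have hW : W.IsSymmetric := fun x y => by
    simp only [W, LinearMap.comp_apply]
    rw [hSsymm, hA', hSsymm]
  obtain ⟨e, r, he⟩ := exists_orthonormal_eigenbasis hW
  have hA'W : ∀ x, A' x = R (W (R x)) := fun x => by simp [W, hRS, hSR]
  have hinner : ∀ l x, ⟪R (e l), x⟫ = ⟪e l, R x⟫ := fun l x => hR.1 _ _
  refine ⟨fun l => R (e l), fun l => S (e l), r, fun x => ?_, fun x => ?_, fun l p => ?_,
    fun l => ?_, fun s t => ?_, ?_⟩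
  · rw [← hRA']
    conv_lhs => rw [← e.sum_repr' (R x)]
    simp [map_sum, hinner]
  · rw [hA'W, apply_eq_sum_of_eigenbasis e he]
    simp [map_sum, hinner]
  · rw [hinner, hRS, orthonormal_iff_ite.mp e.orthonormal]
  · rw [hinv, hSR, hSsymm, hSR]
    simp
  · have : s • A + t • A' = R ∘ₗ (s • LinearMap.id + t • W) ∘ₗ R := by
      ext x; simp [hRA', hA'W]
    have hb : ∀ l, (s • (LinearMap.id : G →ₗ[ℝ] G) + t • W) (e l) = (s + t * r l) • e l := fun l => by
      simp [he, add_smul, smul_smul]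
    rw [this, LinearMap.det_comp, LinearMap.det_comp, det_of_eigenbasis e hb, ← hRA,
      LinearMap.det_comp]
    ring
  · have : A' ∘ₗ Ring.inverse A = R ∘ₗ (W ∘ₗ S) := by
      ext x; simp [W, hRS, hinv]
    rw [this, LinearMap.trace_comp_comm']
    have : (W ∘ₗ S) ∘ₗ R = W := by ext x; simp [hSR]
    rw [this, LinearMap.trace_eq_sum_inner W e]
    simp [he, inner_smul_right]

end Spectral

theorem sum_mul_log_le_of_resolvent {α β : Type*} [Fintype α] [Fintype β]
    (p μ : α → ℝ) (q ν : β → ℝ) (hμ : ∀ a, 0 < μ a) (hν : ∀ b, 0 < ν b)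
    (hpq : ∑ a, p a = ∑ b, q b)
    (h : ∀ t : ℝ, 0 < t →
      ∑ b, q b * (ν b / (1 + t * ν b)) ≤ ∑ a, p a * (μ a / (1 + t * μ a))) :
    ∑ b, q b * Real.log (ν b) ≤ ∑ a, p a * Real.log (μ a) := by
  let g : ℝ → ℝ := fun t =>
    ∑ a, p a * Real.log (1 + t * μ a) - ∑ b, q b * Real.log (1 + t * ν b)
  have hone : ∀ {x t : ℝ}, 0 < x → 0 ≤ t → 0 < 1 + t * x := fun hx ht => by positivity
  have hderiv : ∀ t : ℝ, 0 ≤ t → HasDerivAt g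
      (∑ a, p a * (μ a / (1 + t * μ a)) - ∑ b, q b * (ν b / (1 + t * ν b))) t := by
    have key : ∀ (x t : ℝ), 0 < x → 0 ≤ t →
        HasDerivAt (fun t => Real.log (1 + t * x)) (x / (1 + t * x)) t := fun x t hx ht => by
      have h1 : HasDerivAt (fun t : ℝ => 1 + t * x) x t := by
        simpa using ((hasDerivAt_id t).mul_const x).const_add 1
      exact h1.log (hone hx ht).ne'
    intro t ht
    exact (HasDerivAt.fun_sum fun a _ => (key _ t (hμ a) ht).const_mul (p a)).sub
      (HasDerivAt.fun_sum fun b _ => (key _ t (hν b) ht).const_mul (q b))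
  have hmono : MonotoneOn g (Set.Ici 0) := by
    refine monotoneOn_of_deriv_nonneg (convex_Ici 0)
      (fun t ht => (hderiv t ht).continuousAt.continuousWithinAt)
      (fun t ht => ?_) (fun t ht => ?_)
    · rw [interior_Ici] at ht
      exact (hderiv t (le_of_lt ht)).differentiableAt.differentiableWithinAt
    · rw [interior_Ici] at ht
      rw [(hderiv t (le_of_lt ht)).deriv]
      exact sub_nonneg.mpr (h t ht)
  have hg : ∀ t : ℝ, 0 ≤ t → 0 ≤ g t := fun t ht => by
    have := hmono (Set.mem_Ici.mpr le_rfl) (Set.mem_Ici.mpr ht) ht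
    simpa [g] using this
  let k : ℝ → ℝ := fun s =>
    ∑ a, p a * Real.log (s + μ a) - ∑ b, q b * Real.log (s + ν b)
  have hk : ∀ s : ℝ, 0 < s → 0 ≤ k s := fun s hs => by
    have key : ∀ x : ℝ, 0 < x → Real.log (1 + s⁻¹ * x) = Real.log (s + x) - Real.log s :=
      fun x hx => by
        rw [← Real.log_div (by positivity) hs.ne']
        congr 1
        field_simp
    have := hg s⁻¹ (by positivity)
    simp only [g, key _ (hμ _), key _ (hν _), mul_sub, Finset.sum_sub_distrib,
      ← Finset.sum_mul, hpq] at this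
    simp only [k]
    linarith
  have hcont : ContinuousAt k 0 := by
    have key : ∀ x : ℝ, 0 < x → ContinuousAt (fun s : ℝ => Real.log (s + x)) 0 :=
      fun x hx => ContinuousAt.log (by fun_prop) (by simpa using hx.ne')
    exact (tendsto_finsetSum _ fun a _ => (key _ (hμ a)).const_mul (p a)).sub
      (tendsto_finsetSum _ fun b _ => (key _ (hν b)).const_mul (q b))
  have : 0 ≤ k 0 := by
    refine ge_of_tendsto (hcont.tendsto.mono_left (nhdsWithin_le_nhds (s := Set.Ioi 0))) ?_
    filter_upwards [self_mem_nhdsWithin] with s hs using hk s hs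
  simpa [k] using this

theorem exists_nonneg_combination_of_isCompact {W : Type*} [NormedAddCommGroup W]
    [NormedSpace ℝ W] [FiniteDimensional ℝ W] {S : Set (W →L[ℝ] ℝ)} (hS : IsCompact S)
    {w₀ : W} (hw₀ : ∀ φ ∈ S, φ w₀ = 1) {ψ : W →L[ℝ] ℝ}
    (hψ : ∀ w, (∀ φ ∈ S, 0 ≤ φ w) → 0 ≤ ψ w) :
    ∃ (n : ℕ) (a : Fin n → ℝ) (z : Fin n → W →L[ℝ] ℝ),
      (∀ i, 0 ≤ a i) ∧ (∀ i, z i ∈ S) ∧ ψ = ∑ i, a i • z i := by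
  have ht : 0 ≤ ψ w₀ := hψ w₀ fun φ hφ => by simp [hw₀ φ hφ]
  rcases ht.eq_or_lt with ht | ht
  · have key : ∀ w, 0 ≤ ψ w := fun w => by
      obtain ⟨M, hM⟩ := (hS.image (f := fun φ : W →L[ℝ] ℝ => φ w)
        (by fun_prop)).bddBelow
      have := hψ (w - M • w₀) fun φ hφ => by
        simpa [hw₀ φ hφ] using hM (Set.mem_image_of_mem _ hφ)
      simpa [← ht] using this
    refine ⟨0, Fin.elim0, Fin.elim0, fun i => i.elim0, fun i => i.elim0, ?_⟩
    ext w
    have := key (-w)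
    rw [map_neg] at this
    simpa using le_antisymm (by linarith) (key w)
  · have hmem : (ψ w₀)⁻¹ • ψ ∈ convexHull ℝ S := by
      by_contra hnot
      obtain ⟨f, s, hfs, hsf⟩ := geometric_hahn_banach_point_closed (convex_convexHull ℝ S)
        (isCompact_convexHull_of_isCompact hS).isClosed hnot
      let f' : Module.Dual ℝ (Module.Dual ℝ W) :=
        f.toLinearMap ∘ₗ (LinearMap.toContinuousLinearMap : (W →ₗ[ℝ] ℝ) ≃ₗ[ℝ] _).toLinearMap
      obtain ⟨w, hw⟩ := (Module.evalEquiv ℝ W).surjective f'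
      have hf : ∀ φ : W →L[ℝ] ℝ, f φ = φ w := fun φ => by
        have := LinearMap.congr_fun hw φ.toLinearMap
        simp [f'] at this
        rw [this]; congr 1
      have := hψ (w - s • w₀) fun φ hφ => by
        have := hsf φ (subset_convexHull ℝ S hφ)
        rw [hf] at this
        simpa [hw₀ φ hφ] using this.le
      rw [hf] at hfs
      simp only [map_sub, map_smul, smul_eq_mul, FunLike.coe_smul, Pi.smul_apply] at this hfs
      rw [inv_mul_lt_iff₀ ht] at hfs
      linarith [mul_comm s (ψ w₀)]
    obtain ⟨ι, _, a, z, ha, -, hz, hsum⟩ := mem_convexHull_iff_exists_fintype.mp hmem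
    let e := Fintype.equivFin ι
    refine ⟨Fintype.card ι, fun i => ψ w₀ * a (e.symm i), fun i => z (e.symm i),
      fun i => mul_nonneg ht.le (ha _), fun i => hz _, ?_⟩
    rw [e.symm.sum_comp fun i => (ψ w₀ * a i) • z i]
    simp_rw [mul_smul, ← Finset.smul_sum, hsum, smul_smul]
    rw [mul_inv_cancel₀ ht.ne', one_smul]

section Perturbation

variable {G : Type*} [NormedAddCommGroup G] [InnerProductSpace ℝ G]

theorem inner_eq_sum_of_apply_eq_sum {ι : Type*} [Fintype ι] {A : G →ₗ[ℝ] G} {u : ι → G}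
    {r : ι → ℝ} (h : ∀ x, A x = ∑ l, (r l * ⟪u l, x⟫) • u l) (x : G) :
    ⟪A x, x⟫ = ∑ l, r l * ⟪u l, x⟫ ^ 2 := by
  simp only [h, sum_inner, inner_smul_left, conj_trivial]
  exact Finset.sum_congr rfl fun l _ => by ring

variable [FiniteDimensional ℝ G]

theorem PosDef.eventually_add_smul {A A' : G →ₗ[ℝ] G} (hA : PosDef A) (hA' : A'.IsSymmetric) :
    ∀ᶠ s in nhds (0 : ℝ), PosDef (A + s • A') := by
  obtain ⟨u, f, r, hu, hr, -⟩ := hA.exists_simultaneous_diagonalization hA'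
  have : ∀ᶠ s in nhds (0 : ℝ), ∀ l, 0 < 1 + s * r l := by
    rw [Filter.eventually_all]
    intro l
    have : ContinuousAt (fun s : ℝ => 1 + s * r l) 0 := by fun_prop
    exact this.eventually (lt_mem_nhds (by simp))
  filter_upwards [this] with s hs
  have hform : ∀ x, ⟪(A + s • A') x, x⟫ = ∑ l, (1 + s * r l) * ⟪u l, x⟫ ^ 2 := fun x => by
    refine inner_eq_sum_of_apply_eq_sum (fun x => ?_) x
    simp [hu, hr, add_mul, add_smul, Finset.sum_add_distrib, Finset.smul_sum, smul_smul, mul_assoc]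
  refine ⟨hA.1.add fun x y => ?_, fun x hx => ?_⟩
  · simp [inner_smul_left, inner_smul_right, hA' x y]
  · rw [hform]
    refine lt_of_le_of_ne (Finset.sum_nonneg fun l _ => mul_nonneg (hs l).le (sq_nonneg _)) ?_
    intro h0
    rw [eq_comm, Finset.sum_eq_zero_iff_of_nonneg
      fun l _ => mul_nonneg (hs l).le (sq_nonneg _)] at h0
    have hA0 := hA.2 x hx
    have : ∀ l, ⟪u l, x⟫ = 0 := fun l => by
      have := (mul_eq_zero.mp (h0 l (Finset.mem_univ l))).resolve_left (hs l).ne'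
      simpa using this
    rw [hu] at hA0
    simp [this] at hA0

theorem PosDef.hasDerivAt_log_det {A A' : G →ₗ[ℝ] G} (hA : PosDef A) (hA' : A'.IsSymmetric) :
    HasDerivAt (fun s : ℝ => Real.log (LinearMap.det (A + s • A')))
      (LinearMap.trace ℝ G (A' ∘ₗ Ring.inverse A)) 0 := by
  obtain ⟨u, f, r, -, -, -, -, hdet, htr⟩ := hA.exists_simultaneous_diagonalization hA'
  have hdet' : ∀ s : ℝ, LinearMap.det (A + s • A') = LinearMap.det A * ∏ l, (1 + s * r l) :=
    fun s => by simpa using hdet 1 s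
  have hprod : HasDerivAt (fun s : ℝ => ∏ l, (1 + s * r l)) (∑ l, r l) 0 := by
    have := HasDerivAt.fun_finsetProd (u := Finset.univ) (f := fun l (s : ℝ) => 1 + s * r l)
      (f' := r) (x := 0) fun l _ => by simpa using ((hasDerivAt_id _).mul_const (r l)).const_add 1
    simpa using this
  have := (hprod.const_mul (LinearMap.det A)).log (by simpa using hA.det_pos.ne')
  simp_rw [hdet', htr]
  simpa [mul_div_cancel_left₀ _ hA.det_pos.ne'] using this

theorem trace_adjoint (A : G →ₗ[ℝ] G) :
    LinearMap.trace ℝ G (LinearMap.adjoint A) = LinearMap.trace ℝ G A := by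
  let b := stdOrthonormalBasis ℝ G
  simp only [LinearMap.trace_eq_sum_inner _ b, LinearMap.adjoint_inner_right]
  simp only [real_inner_comm]

theorem trace_adjoint_comp {A S : G →ₗ[ℝ] G} (hS : S.IsSymmetric) :
    LinearMap.trace ℝ G (LinearMap.adjoint A ∘ₗ S) = LinearMap.trace ℝ G (A ∘ₗ S) := by
  have h : LinearMap.adjoint S = S := (LinearMap.isSymmetric_iff_isSelfAdjoint S).mp hS
  rw [← trace_adjoint, LinearMap.adjoint_comp, LinearMap.adjoint_adjoint, h,
    LinearMap.trace_comp_comm']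

theorem trace_rankOne_comp (v : G) (A : G →ₗ[ℝ] G) :
    LinearMap.trace ℝ G ((innerₛₗ ℝ v).smulRight v ∘ₗ A) = ⟪A v, v⟫ := by
  have : (innerₛₗ ℝ v).smulRight v ∘ₗ A = (innerₛₗ ℝ v ∘ₗ A).smulRight v := by
    ext; simp
  rw [this, LinearMap.trace_smulRight]
  simp [real_inner_comm]

/-- The sum of squared inner products against the images of an orthonormal basis under a
square root of `P`. -/
theorem sum_sq_inner_sqrt {H ι : Type*} [NormedAddCommGroup H] [InnerProductSpace ℝ H]
    [FiniteDimensional ℝ H] [Fintype ι] (e : OrthonormalBasis ι ℝ H) {R : H →ₗ[ℝ] H}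
    (hR : R.IsSymmetric) (L : H →ₗ[ℝ] G) (w : G) :
    ∑ a, ⟪w, L (R (e a))⟫ ^ 2 =
      ⟪(L ∘ₗ (R ∘ₗ R) ∘ₗ LinearMap.adjoint L) w, w⟫ := by
  have h : ∀ a, ⟪w, L (R (e a))⟫ = ⟪e a, R (LinearMap.adjoint L w)⟫ := fun a => by
    rw [← LinearMap.adjoint_inner_left, ← hR, real_inner_comm]
  simp only [h, LinearMap.comp_apply]
  rw [← LinearMap.adjoint_inner_right, hR, ← e.sum_inner_mul_inner]
  refine Finset.sum_congr rfl fun a _ => ?_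
  rw [sq, real_inner_comm (e a)]

end Perturbation

section Structure

variable {k m : ℕ}
  {E : Fin k → Type*} {F : Fin m → Type*}
  [∀ i, NormedAddCommGroup (E i)] [∀ i, InnerProductSpace ℝ (E i)]
  [∀ j, NormedAddCommGroup (F j)] [∀ j, InnerProductSpace ℝ (F j)]
  [∀ j, FiniteDimensional ℝ (F j)]
  {c : Fin k → ℝ} {d : Fin m → ℝ} {B : ∀ i j, E i →ₗ[ℝ] F j}
  {V : ∀ i, E i →ₗ[ℝ] E i} {U : ∀ j, F j →ₗ[ℝ] F j}

theorem projL_apply (i : Fin k) (x : PiLp 2 E) : projL E i x = x i := rfl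

theorem projL_singleL_same (i : Fin k) (v : E i) : projL E i (singleL E i v) = v := by
  simp [projL, singleL, toPi]

theorem projL_singleL_of_ne {i i' : Fin k} (h : i' ≠ i) (v : E i) :
    projL E i' (singleL E i v) = 0 := by
  simp [projL, singleL, toPi, Pi.single_eq_of_ne h]

theorem inner_singleL (i : Fin k) (v : E i) (x : PiLp 2 E) :
    ⟪singleL E i v, x⟫ = ⟪v, projL E i x⟫ := by
  rw [PiLp.inner_apply, Finset.sum_eq_single i]
  · rw [← projL_apply, projL_singleL_same, projL_apply]
  · intro i' _ h
    rw [← projL_apply, projL_singleL_of_ne h, inner_zero_left]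
  · simp

variable [∀ i, FiniteDimensional ℝ (E i)]

theorem adjoint_projL (i : Fin k) : LinearMap.adjoint (projL E i) = singleL E i := by
  refine LinearMap.ext fun v => ext_inner_right ℝ fun x => ?_
  rw [LinearMap.adjoint_inner_left, inner_singleL]

theorem inner_Theta (x y : PiLp 2 E) :
    ⟪Theta E F c d B V U x, y⟫ =
      ∑ i, c i * ⟪V i (projL E i x), projL E i y⟫ -
        ∑ j, d j * ⟪U j (BLam E F c B j x), BLam E F c B j y⟫ := by
  simp [Theta, blockDiag, inner_sub_left, sum_inner, inner_smul_left, inner_singleL,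
    LinearMap.adjoint_inner_left]

theorem isSymmetric_Theta (hV : ∀ i, (V i).IsSymmetric) (hU : ∀ j, (U j).IsSymmetric) :
    (Theta E F c d B V U).IsSymmetric := fun x y => by
  rw [real_inner_comm _ x, inner_Theta, inner_Theta]
  congr 1
  · exact Finset.sum_congr rfl fun i _ => by rw [hV i, real_inner_comm]
  · exact Finset.sum_congr rfl fun j _ => by rw [hU j, real_inner_comm]

/-- Averaging weighted sums of squares against a coupling `P = R²`. -/
theorem sum_sqrt_coupling {κ : Fin k → Type*} {η : Fin m → Type*} [∀ i, Fintype (κ i)]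
    [∀ j, Fintype (η j)] {ι : Type*} [Fintype ι] (e : OrthonormalBasis ι ℝ (PiLp 2 E))
    {A : ∀ i, E i →ₗ[ℝ] E i} {R : PiLp 2 E →ₗ[ℝ] PiLp 2 E} (hR : R.IsSymmetric)
    (hP : R ∘ₗ R ∈ Coupling E A)
    (v : ∀ i, κ i → E i) (ρ : ∀ i, κ i → ℝ) (u : ∀ j, η j → F j) (σ : ∀ j, η j → ℝ) :
    ∑ a, (∑ i, c i * ∑ l, ρ i l * ⟪v i l, projL E i (R (e a))⟫ ^ 2 -
        ∑ j, d j * ∑ l, σ j l * ⟪u j l, BLam E F c B j (R (e a))⟫ ^ 2) =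
      ∑ i, c i * ∑ l, ρ i l * ⟪A i (v i l), v i l⟫ -
        ∑ j, d j * ∑ l, σ j l *
          ⟪((BLam E F c B j) ∘ₗ (R ∘ₗ R) ∘ₗ LinearMap.adjoint (BLam E F c B j)) (u j l),
            u j l⟫ := by
  have h : ∀ i w, ∑ a, ⟪w, projL E i (R (e a))⟫ ^ 2 = ⟪A i w, w⟫ := fun i w => by
    rw [sum_sq_inner_sqrt e hR, ← hP.2 i w, LinearMap.comp_apply, real_inner_comm,
      ← LinearMap.adjoint_inner_left, real_inner_comm, adjoint_projL]
    rfl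
  simp only [← h, ← sum_sq_inner_sqrt e hR]
  rw [Finset.sum_sub_distrib]
  congr 1
  · rw [Finset.sum_comm]
    refine Finset.sum_congr rfl fun i _ => ?_
    rw [← Finset.mul_sum, Finset.sum_comm]
    simp only [Finset.mul_sum]
  · rw [Finset.sum_comm]
    refine Finset.sum_congr rfl fun i _ => ?_
    rw [← Finset.mul_sum, Finset.sum_comm]
    simp only [Finset.mul_sum]

/-- `tr (P^{1/2} Θ P^{1/2}) = ∑ᵢ cᵢ dim Eᵢ - ∑ⱼ dⱼ tr (Uⱼ Qⱼ P Qⱼ*)` for a coupling `P`. -/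
theorem trace_sqrt_Theta_sqrt {κ : Fin m → Type*} [∀ j, Fintype (κ j)]
    (hV : ∀ i, PosDef (V i)) {R : PiLp 2 E →ₗ[ℝ] PiLp 2 E} (hR : R.IsSymmetric)
    (hP : R ∘ₗ R ∈ Coupling E (fun i => Ring.inverse (V i)))
    (u : ∀ j, κ j → F j) (hu : ∀ j x, U j x = ∑ l, ⟪u j l, x⟫ • u j l) :
    LinearMap.trace ℝ _ ((R ∘ₗ Theta E F c d B V U) ∘ₗ R) =
      ∑ i, c i * (Module.finrank ℝ (E i) : ℝ) - ∑ j, d j * ∑ l,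
          ⟪((BLam E F c B j) ∘ₗ (R ∘ₗ R) ∘ₗ LinearMap.adjoint (BLam E F c B j)) (u j l),
            u j l⟫ := by
  choose v f r hv _ _ hone _ _ using fun i =>
    (hV i).exists_simultaneous_diagonalization (A' := 0) LinearMap.IsSymmetric.zero
  let e := stdOrthonormalBasis ℝ (PiLp 2 E)
  have hVq : ∀ i x, ⟪V i x, x⟫ = ∑ l, 1 * ⟪v i l, x⟫ ^ 2 := fun i =>
    inner_eq_sum_of_apply_eq_sum fun x => by simp [hv]
  have hUq : ∀ j x, ⟪U j x, x⟫ = ∑ l, 1 * ⟪u j l, x⟫ ^ 2 := fun j =>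
    inner_eq_sum_of_apply_eq_sum fun x => by simp [hu]
  have := sum_sqrt_coupling (c := c) (d := d) (B := B) e hR hP v (fun _ _ => 1) u (fun _ _ => 1)
  simp only [hone, one_mul, Finset.sum_const, Finset.card_univ, Fintype.card_fin,
    nsmul_eq_mul, mul_one] at this
  rw [← this, LinearMap.trace_eq_sum_inner _ e]
  refine Finset.sum_congr rfl fun a _ => ?_
  rw [LinearMap.comp_apply, LinearMap.comp_apply, ← hR, real_inner_comm, inner_Theta]
  simp only [hVq, hUq, one_mul]

theorem resolvent_bound_le {a p q t ν : ℝ} (ht : 0 < t) (hν : 0 < ν) (h : a = p + q) :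
    ν / (1 + t * ν) * a ^ 2 ≤ ν * p ^ 2 + t⁻¹ * q ^ 2 := by
  have h1 : 0 < 1 + t * ν := by positivity
  have : ν * p ^ 2 + t⁻¹ * q ^ 2 - ν / (1 + t * ν) * a ^ 2 =
      (t * ν * p - q) ^ 2 / (t * (1 + t * ν)) := by
    subst h; field_simp; ring
  have : 0 ≤ (t * ν * p - q) ^ 2 / (t * (1 + t * ν)) := by positivity
  linarith

/-- The constraint `Θ ≥ 0` is preserved by parallel addition with a feasible pair. -/
theorem sum_resolvent_le_sum_resolvent {κ : Fin k → Type*} {η : Fin m → Type*}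
    [∀ i, Fintype (κ i)] [∀ i, DecidableEq (κ i)] [∀ j, Fintype (η j)]
    (hd : ∀ j, 0 < d j) {V' : ∀ i, E i →ₗ[ℝ] E i} {U' : ∀ j, F j →ₗ[ℝ] F j}
    (hΘ : PosSemidef (Theta E F c d B V U)) (hΘ' : PosSemidef (Theta E F c d B V' U'))
    {v f : ∀ i, κ i → E i} {μ : ∀ i, κ i → ℝ} {u : ∀ j, η j → F j} {ν : ∀ j, η j → ℝ}
    (hv : ∀ i x, ⟪V i x, x⟫ = ∑ l, ⟪v i l, x⟫ ^ 2)
    (hv' : ∀ i x, ⟪V' i x, x⟫ = ∑ l, μ i l * ⟪v i l, x⟫ ^ 2)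
    (hu : ∀ j x, ⟪U j x, x⟫ = ∑ l, ⟪u j l, x⟫ ^ 2)
    (hu' : ∀ j x, ⟪U' j x, x⟫ = ∑ l, ν j l * ⟪u j l, x⟫ ^ 2)
    (hf : ∀ i l p, ⟪v i l, f i p⟫ = if l = p then 1 else 0)
    (hμ : ∀ i l, 0 < μ i l) (hν : ∀ j l, 0 < ν j l) {t : ℝ} (ht : 0 < t) (x : PiLp 2 E) :
    ∑ j, d j * ∑ l, ν j l / (1 + t * ν j l) * ⟪u j l, BLam E F c B j x⟫ ^ 2 ≤
      ∑ i, c i * ∑ l, μ i l / (1 + t * μ i l) * ⟪v i l, projL E i x⟫ ^ 2 := by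
  let y : PiLp 2 E := WithLp.toLp 2 fun i => ∑ l, (⟪v i l, x i⟫ / (1 + t * μ i l)) • f i l
  have hy : ∀ i l, ⟪v i l, projL E i y⟫ = ⟪v i l, projL E i x⟫ / (1 + t * μ i l) := fun i l => by
    simp [projL_apply, y, inner_sum, inner_smul_right, hf]
  have h1 := hΘ'.2 y
  have h2 := hΘ.2 (x - y)
  rw [inner_Theta] at h1 h2
  simp only [hv, hv', hu, hu'] at h1 h2
  simp only [map_sub, inner_sub_right] at h2
  calc
    _ ≤ ∑ j, d j * ∑ l, (ν j l * ⟪u j l, BLam E F c B j y⟫ ^ 2 +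
          t⁻¹ * (⟪u j l, BLam E F c B j x⟫ - ⟪u j l, BLam E F c B j y⟫) ^ 2) := by
      gcongr with j _ l _
      · exact (hd j).le
      · exact resolvent_bound_le ht (hν j l) (by ring)
    _ = ∑ j, d j * ∑ l, ν j l * ⟪u j l, BLam E F c B j y⟫ ^ 2 +
          t⁻¹ * ∑ j, d j * ∑ l, (⟪u j l, BLam E F c B j x⟫ - ⟪u j l, BLam E F c B j y⟫) ^ 2 := by
      simp only [Finset.sum_add_distrib, mul_add, Finset.mul_sum]
      simp only [mul_left_comm]
    _ ≤ ∑ i, c i * ∑ l, μ i l * ⟪v i l, projL E i y⟫ ^ 2 +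
          t⁻¹ * ∑ i, c i * ∑ l, (⟪v i l, projL E i x⟫ - ⟪v i l, projL E i y⟫) ^ 2 := by
      gcongr
      · linarith
      · linarith
    _ = ∑ i, c i * ∑ l, (μ i l * ⟪v i l, projL E i y⟫ ^ 2 +
          t⁻¹ * (⟪v i l, projL E i x⟫ - ⟪v i l, projL E i y⟫) ^ 2) := by
      simp only [Finset.sum_add_distrib, mul_add, Finset.mul_sum]
      simp only [mul_left_comm]
    _ = _ := by
      refine Finset.sum_congr rfl fun i _ => congrArg _ <| Finset.sum_congr rfl fun l _ => ?_
      have : 0 < 1 + t * μ i l := by have := hμ i l; positivity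
      have hsub (a : ℝ) : a - a / (1 + t * μ i l) = t * (μ i l * a) / (1 + t * μ i l) := by
        field_simp
        ring
      rw [hy, hsub]
      field_simp

theorem PosDef.exists_simultaneous_diagonalization_of_posDef {G : Type*} [NormedAddCommGroup G]
    [InnerProductSpace ℝ G] [FiniteDimensional ℝ G] {A A' : G →ₗ[ℝ] G}
    (hA : PosDef A) (hA' : PosDef A') :
    ∃ (u f : Fin (Module.finrank ℝ G) → G) (r : Fin (Module.finrank ℝ G) → ℝ),
      (∀ x, ⟪A x, x⟫ = ∑ l, ⟪u l, x⟫ ^ 2) ∧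
      (∀ x, ⟪A' x, x⟫ = ∑ l, r l * ⟪u l, x⟫ ^ 2) ∧
      (∀ l p, ⟪u l, f p⟫ = if l = p then 1 else 0) ∧
      (∀ l, ⟪Ring.inverse A (u l), u l⟫ = 1) ∧ (∀ l, 0 < r l) ∧
      Real.log (LinearMap.det A') = Real.log (LinearMap.det A) + ∑ l, Real.log (r l) := by
  obtain ⟨u, f, r, hu, hr, hf, hone, hdet, -⟩ := hA.exists_simultaneous_diagonalization hA'.1
  have hq := inner_eq_sum_of_apply_eq_sum hr
  have hpos : ∀ l, 0 < r l := fun l => by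
    have hne : f l ≠ 0 := fun h => by simpa [h] using hf l l
    simpa [hq, hf] using hA'.2 (f l) hne
  refine ⟨u, f, r, fun x => ?_, hq, hf, hone, hpos, ?_⟩
  · simpa using inner_eq_sum_of_apply_eq_sum (r := fun _ => 1) (by simpa using hu) x
  · have h := hdet 0 1
    simp only [zero_smul, one_smul, zero_add, one_mul] at h
    rw [h, Real.log_mul hA.det_pos.ne' (Finset.prod_pos fun l _ => hpos l).ne',
      Real.log_prod fun l _ => (hpos l).ne']

theorem isGlobalMax_of_coupling (hd : ∀ j, 0 < d j) (hV : ∀ i, PosDef (V i))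
    (hU : ∀ j, PosDef (U j)) (hscal : ScalingCond E F c d) {P : PiLp 2 E →ₗ[ℝ] PiLp 2 E}
    (hP : P ∈ Coupling E (fun i => Ring.inverse (V i)))
    (hUP : ∀ j, Ring.inverse (U j) =
      (BLam E F c B j) ∘ₗ P ∘ₗ LinearMap.adjoint (BLam E F c B j))
    (hΘ : PosSemidef (Theta E F c d B V U)) : IsGlobalMax E F c d B V U := by
  refine ⟨⟨hV, hU, hΘ⟩, fun V' U' ⟨hV', hU', hΘ'⟩ => ?_⟩
  choose v f μ hv hv' hf hvone hμ hVdet using fun i =>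
    (hV i).exists_simultaneous_diagonalization_of_posDef (hV' i)
  choose u _ ν hu hu' _ huone hν hUdet using fun j =>
    (hU j).exists_simultaneous_diagonalization_of_posDef (hU' j)
  obtain ⟨R, hR, rfl⟩ := hP.1.exists_sqrt
  have key := sum_mul_log_le_of_resolvent
    (fun a : Σ i, Fin (Module.finrank ℝ (E i)) => c a.1) (fun a => μ a.1 a.2)
    (fun b : Σ j, Fin (Module.finrank ℝ (F j)) => d b.1) (fun b => ν b.1 b.2)
    (fun a => hμ _ _) (fun b => hν _ _)
    (by simpa [Fintype.sum_sigma, mul_comm, ScalingCond] using hscal) fun t ht => by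
      have hsum := sum_sqrt_coupling (c := c) (d := d) (B := B)
        (stdOrthonormalBasis ℝ (PiLp 2 E)) hR.1 hP v (fun i l => μ i l / (1 + t * μ i l))
        u (fun j l => ν j l / (1 + t * ν j l))
      have hnonneg := Finset.sum_nonneg fun a (_ : a ∈ Finset.univ) => sub_nonneg.mpr
        (sum_resolvent_le_sum_resolvent hd hΘ hΘ' hv hv' hu hu' hf hμ hν ht
          (R (stdOrthonormalBasis ℝ (PiLp 2 E) a)))
      rw [hsum] at hnonneg
      simp only [← hUP, hvone, huone, mul_one] at hnonneg
      simpa [Fintype.sum_sigma, Finset.mul_sum] using hnonneg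
  simp only [Fintype.sum_sigma, ← Finset.mul_sum] at key
  simp only [objective, hVdet, hUdet, mul_add, Finset.sum_add_distrib]
  linarith

theorem scalingCond_of_trace_eq_zero (hV : ∀ i, PosDef (V i)) (hU : ∀ j, PosDef (U j))
    {R : PiLp 2 E →ₗ[ℝ] PiLp 2 E} (hR : R.IsSymmetric)
    (hP : R ∘ₗ R ∈ Coupling E (fun i => Ring.inverse (V i)))
    (hUP : ∀ j, Ring.inverse (U j) =
      (BLam E F c B j) ∘ₗ (R ∘ₗ R) ∘ₗ LinearMap.adjoint (BLam E F c B j)) :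
    LinearMap.trace ℝ _ ((R ∘ₗ Theta E F c d B V U) ∘ₗ R) = 0 ↔ ScalingCond E F c d := by
  choose u _ r hu _ _ huone _ _ using fun j =>
    (hU j).exists_simultaneous_diagonalization (A' := 0) LinearMap.IsSymmetric.zero
  rw [trace_sqrt_Theta_sqrt hV hR hP u hu]
  simp only [← hUP, huone]
  simp [ScalingCond, sub_eq_zero]

theorem inverse_eq_of_inverse_ge (hd : ∀ j, 0 < d j) (hV : ∀ i, PosDef (V i))
    (hU : ∀ j, PosDef (U j)) (hscal : ScalingCond E F c d)
    {R : PiLp 2 E →ₗ[ℝ] PiLp 2 E} (hR : R.IsSymmetric)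
    (hP : R ∘ₗ R ∈ Coupling E (fun i => Ring.inverse (V i)))
    (hUP : ∀ (j : Fin m) (w : F j),
      ⟪((BLam E F c B j) ∘ₗ (R ∘ₗ R) ∘ₗ LinearMap.adjoint (BLam E F c B j)) w, w⟫ ≤
        ⟪Ring.inverse (U j) w, w⟫)
    (hRΘ : (R ∘ₗ Theta E F c d B V U) ∘ₗ R = 0) (j : Fin m) :
    Ring.inverse (U j) =
      (BLam E F c B j) ∘ₗ (R ∘ₗ R) ∘ₗ LinearMap.adjoint (BLam E F c B j) := by
  choose u _ r hu _ _ huone _ _ using fun j =>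
    (hU j).exists_simultaneous_diagonalization (A' := 0) LinearMap.IsSymmetric.zero
  set M : ∀ j, F j →ₗ[ℝ] F j := fun j =>
    (BLam E F c B j) ∘ₗ (R ∘ₗ R) ∘ₗ LinearMap.adjoint (BLam E F c B j) with hM
  have htr := trace_sqrt_Theta_sqrt (c := c) (d := d) (B := B) hV hR hP u hu
  rw [hRΘ, map_zero, hscal] at htr
  have hMsymm : (M j).IsSymmetric := fun x y => by
    simp only [hM, LinearMap.comp_apply]
    rw [← LinearMap.adjoint_inner_right, hR, hR, LinearMap.adjoint_inner_left]
  have hD : PosSemidef (Ring.inverse (U j) - M j) :=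
    ⟨(hU j).isSymmetric_inverse.sub hMsymm, fun x => by
      rw [LinearMap.sub_apply, inner_sub_left]
      exact sub_nonneg.mpr (hUP j x)⟩
  have hle : ∀ j l, 0 ≤ 1 - ⟪M j (u j l), u j l⟫ := fun j l => by
    have := hUP j (u j l)
    rw [huone] at this
    exact sub_nonneg.mpr this
  have hsum : ∑ j, d j * ∑ l, (1 - ⟪M j (u j l), u j l⟫) = 0 := by
    simp only [Finset.sum_sub_distrib, mul_sub]
    simp only [Finset.sum_const, Finset.card_univ, Fintype.card_fin, nsmul_eq_mul, mul_one]
    exact htr.symm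
  have hzero : ∀ l, ⟪M j (u j l), u j l⟫ = 1 := fun l => by
    rw [Finset.sum_eq_zero_iff_of_nonneg fun j _ =>
      mul_nonneg (hd j).le (Finset.sum_nonneg fun l _ => hle j l)] at hsum
    have := (mul_eq_zero.mp (hsum j (Finset.mem_univ j))).resolve_left (hd j).ne'
    rw [Finset.sum_eq_zero_iff_of_nonneg fun l _ => hle j l] at this
    linarith [this l (Finset.mem_univ l)]
  have hDu : ∀ l, (Ring.inverse (U j) - M j) (u j l) = 0 := fun l =>
    hD.apply_eq_zero (by rw [LinearMap.sub_apply, inner_sub_left, huone, hzero, sub_self])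
  refine sub_eq_zero.mp (LinearMap.ext fun x => ?_)
  change (Ring.inverse (U j) - M j) x = 0
  rw [← (hU j).apply_inverse x, hu]
  simp only [map_sum, map_smul, hDu, smul_zero, Finset.sum_const_zero]

theorem eventually_norm_add_smul_sub_lt {X : Type*} [NormedAddCommGroup X]
    [InnerProductSpace ℝ X] [FiniteDimensional ℝ X] (A A' : X →ₗ[ℝ] X) {ε : ℝ} (hε : 0 < ε) :
    ∀ᶠ s in nhds (0 : ℝ), ‖LinearMap.toContinuousLinearMap (A + s • A' - A)‖ < ε := by
  have hc : ContinuousAt (fun s : ℝ => ‖s • LinearMap.toContinuousLinearMap A'‖) 0 := by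
    fun_prop
  simpa using hc.eventually_lt continuousAt_const (by simpa using hε)

theorem inner_Theta_add_smul {H : ∀ i, E i →ₗ[ℝ] E i} {G : ∀ j, F j →ₗ[ℝ] F j} (s : ℝ)
    (x : PiLp 2 E) :
    ⟪Theta E F c d B (fun i => V i + s • H i) (fun j => U j + s • G j) x, x⟫ =
      ⟪Theta E F c d B V U x, x⟫ + s * ⟪Theta E F c d B H G x, x⟫ := by
  simp only [inner_Theta, LinearMap.add_apply, LinearMap.smul_apply, inner_add_left,
    real_inner_smul_left, mul_add, Finset.sum_add_distrib, mul_sub, Finset.mul_sum]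
  simp only [mul_left_comm s]
  ring

/-- First order optimality of a local maximizer in an admissible direction `(H, G)`. -/
theorem IsLocalMax.sum_trace_le (h : IsLocalMax E F c d B V U) {H : ∀ i, E i →ₗ[ℝ] E i}
    {G : ∀ j, F j →ₗ[ℝ] F j} (hH : ∀ i, (H i).IsSymmetric) (hG : ∀ j, (G j).IsSymmetric)
    {τ : ℝ} (hHG : ∀ x, 0 ≤ ⟪Theta E F c d B H G x, x⟫ + τ * ⟪Theta E F c d B V U x, x⟫) :
    ∑ j, d j * LinearMap.trace ℝ _ (G j ∘ₗ Ring.inverse (U j)) ≤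
      ∑ i, c i * LinearMap.trace ℝ _ (H i ∘ₗ Ring.inverse (V i)) := by
  obtain ⟨⟨hV, hU, hΘ⟩, ε, hε, hmax⟩ := h
  have hderiv : HasDerivAt (fun s : ℝ =>
      objective E F c d (fun i => V i + s • H i) (fun j => U j + s • G j))
      (∑ j, d j * LinearMap.trace ℝ _ (G j ∘ₗ Ring.inverse (U j)) -
        ∑ i, c i * LinearMap.trace ℝ _ (H i ∘ₗ Ring.inverse (V i))) 0 :=
    (HasDerivAt.fun_sum fun j _ => ((hU j).hasDerivAt_log_det (hG j)).const_mul (d j)).fun_sub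
      (HasDerivAt.fun_sum fun i _ => ((hV i).hasDerivAt_log_det (hH i)).const_mul (c i))
  refine sub_nonpos.mp (le_of_tendsto hderiv.tendsto_slope_zero_right ?_)
  have hVs := Filter.eventually_all.mpr fun i => (hV i).eventually_add_smul (hH i)
  have hUs := Filter.eventually_all.mpr fun j => (hU j).eventually_add_smul (hG j)
  have hVn := Filter.eventually_all.mpr fun i => eventually_norm_add_smul_sub_lt (V i) (H i) hε
  have hUn := Filter.eventually_all.mpr fun j => eventually_norm_add_smul_sub_lt (U j) (G j) hε
  have hτ : ∀ᶠ s in nhds (0 : ℝ), s * τ < 1 := by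
    have hc : ContinuousAt (fun s : ℝ => s * τ) 0 := by fun_prop
    exact hc.eventually_lt continuousAt_const (by simp)
  filter_upwards [nhdsWithin_le_nhds hVs, nhdsWithin_le_nhds hUs, nhdsWithin_le_nhds hVn,
    nhdsWithin_le_nhds hUn, nhdsWithin_le_nhds hτ, self_mem_nhdsWithin]
    with s hVs hUs hVn hUn hτ hs
  have hs : 0 < s := hs
  have hΘs : PosSemidef
      (Theta E F c d B (fun i => V i + s • H i) (fun j => U j + s • G j)) := by
    refine ⟨isSymmetric_Theta (fun i => (hVs i).1) (fun j => (hUs j).1), fun x => ?_⟩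
    rw [inner_Theta_add_smul]
    have h1 := mul_nonneg hs.le (hHG x)
    have h2 := mul_nonneg (sub_nonneg.mpr hτ.le) (hΘ.2 x)
    linarith
  have hobj := hmax _ _ ⟨hVs, hUs, hΘs⟩ hVn hUn
  refine smul_nonpos_of_nonneg_of_nonpos (inv_nonneg.mpr hs.le) ?_
  simpa using hobj

/-- The quadratic form of the constraint at `x`, as a linear functional of a perturbation `(H, G)`
of `(V, U)`, together with a multiple of the form of `Θ`. -/
def constraintFunctional (E : Fin k → Type*) (F : Fin m → Type*)
    [∀ i, NormedAddCommGroup (E i)] [∀ i, InnerProductSpace ℝ (E i)]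
    [∀ i, FiniteDimensional ℝ (E i)] [∀ j, NormedAddCommGroup (F j)]
    [∀ j, InnerProductSpace ℝ (F j)] [∀ j, FiniteDimensional ℝ (F j)]
    (c : Fin k → ℝ) (d : Fin m → ℝ) (B : ∀ i j, E i →ₗ[ℝ] F j)
    (T : PiLp 2 E →ₗ[ℝ] PiLp 2 E) (x : PiLp 2 E) :
    ((∀ i, E i →L[ℝ] E i) × (∀ j, F j →L[ℝ] F j) × ℝ) →L[ℝ] ℝ :=
  LinearMap.toContinuousLinearMap
    { toFun := fun w => ⟪Theta E F c d B (fun i => w.1 i) (fun j => w.2.1 j) x, x⟫ +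
        w.2.2 * ⟪T x, x⟫
      map_add' := fun w w' => by
        simp only [inner_Theta, Prod.fst_add, Prod.snd_add, Pi.add_apply,
          ContinuousLinearMap.toLinearMap_add, LinearMap.add_apply, inner_add_left, mul_add,
          Finset.sum_add_distrib]
        ring
      map_smul' := fun s w => by
        simp only [inner_Theta, Prod.smul_fst, Prod.smul_snd, Pi.smul_apply,
          ContinuousLinearMap.toLinearMap_smul, LinearMap.smul_apply, real_inner_smul_left,
          mul_left_comm _ s, ← Finset.mul_sum, smul_eq_mul, RingHom.id_apply]
        ring }

theorem constraintFunctional_apply (T : PiLp 2 E →ₗ[ℝ] PiLp 2 E) (x : PiLp 2 E)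
    (w : (∀ i, E i →L[ℝ] E i) × (∀ j, F j →L[ℝ] F j) × ℝ) :
    constraintFunctional E F c d B T x w =
      ⟪Theta E F c d B (fun i => w.1 i) (fun j => w.2.1 j) x, x⟫ + w.2.2 * ⟪T x, x⟫ := rfl

theorem continuous_constraintFunctional (T : PiLp 2 E →ₗ[ℝ] PiLp 2 E) :
    Continuous (constraintFunctional E F c d B T) := by
  refine continuous_clm_apply.mpr fun w => ?_
  simp only [constraintFunctional_apply]
  have h1 := LinearMap.continuous_of_finiteDimensional T
  have h2 := LinearMap.continuous_of_finiteDimensional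
    (Theta E F c d B (fun i => (w.1 i : E i →ₗ[ℝ] E i)) (fun j => (w.2.1 j : F j →ₗ[ℝ] F j)))
  fun_prop

theorem isCompact_image_constraintFunctional (T : PiLp 2 E →ₗ[ℝ] PiLp 2 E) :
    IsCompact (constraintFunctional E F c d B T '' Metric.sphere 0 1) :=
  (isCompact_sphere 0 1).image (continuous_constraintFunctional T)

/-- The derivative at `(V, U)` of the objective function, with the opposite sign. -/
def traceFunctional (E : Fin k → Type*) (F : Fin m → Type*)
    [∀ i, NormedAddCommGroup (E i)] [∀ i, InnerProductSpace ℝ (E i)]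
    [∀ i, FiniteDimensional ℝ (E i)] [∀ j, NormedAddCommGroup (F j)]
    [∀ j, InnerProductSpace ℝ (F j)] [∀ j, FiniteDimensional ℝ (F j)]
    (c : Fin k → ℝ) (d : Fin m → ℝ) (V : ∀ i, E i →ₗ[ℝ] E i) (U : ∀ j, F j →ₗ[ℝ] F j) :
    ((∀ i, E i →L[ℝ] E i) × (∀ j, F j →L[ℝ] F j) × ℝ) →L[ℝ] ℝ :=
  LinearMap.toContinuousLinearMap
    { toFun := fun w => ∑ i, c i * LinearMap.trace ℝ _ (w.1 i ∘ₗ Ring.inverse (V i)) -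
        ∑ j, d j * LinearMap.trace ℝ _ (w.2.1 j ∘ₗ Ring.inverse (U j))
      map_add' := fun w w' => by
        simp only [Prod.fst_add, Prod.snd_add, Pi.add_apply,
          ContinuousLinearMap.toLinearMap_add, LinearMap.add_comp, map_add, mul_add,
          Finset.sum_add_distrib]
        ring
      map_smul' := fun s w => by
        simp only [Prod.smul_fst, Prod.smul_snd, Pi.smul_apply,
          ContinuousLinearMap.toLinearMap_smul, LinearMap.smul_comp, map_smul, smul_eq_mul,
          mul_left_comm _ s, ← Finset.mul_sum, RingHom.id_apply]
        ring }

theorem traceFunctional_apply (w : (∀ i, E i →L[ℝ] E i) × (∀ j, F j →L[ℝ] F j) × ℝ) :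
    traceFunctional E F c d V U w =
      ∑ i, c i * LinearMap.trace ℝ _ (w.1 i ∘ₗ Ring.inverse (V i)) -
        ∑ j, d j * LinearMap.trace ℝ _ (w.2.1 j ∘ₗ Ring.inverse (U j)) := rfl

theorem inner_symmetrization_apply {X : Type*} [NormedAddCommGroup X] [InnerProductSpace ℝ X]
    [FiniteDimensional ℝ X] (A : X →ₗ[ℝ] X) (x : X) :
    ⟪((1 / 2 : ℝ) • (A + LinearMap.adjoint A)) x, x⟫ = ⟪A x, x⟫ := by
  rw [LinearMap.smul_apply, LinearMap.add_apply, real_inner_smul_left, inner_add_left,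
    LinearMap.adjoint_inner_left, real_inner_comm]
  ring

theorem isSymmetric_symmetrization {X : Type*} [NormedAddCommGroup X] [InnerProductSpace ℝ X]
    [FiniteDimensional ℝ X] (A : X →ₗ[ℝ] X) :
    ((1 / 2 : ℝ) • (A + LinearMap.adjoint A)).IsSymmetric := fun x y => by
  simp only [LinearMap.smul_apply, LinearMap.add_apply, real_inner_smul_left,
    real_inner_smul_right, inner_add_left, inner_add_right, LinearMap.adjoint_inner_left,
    LinearMap.adjoint_inner_right]
  ring

theorem trace_symmetrization_comp {X : Type*} [NormedAddCommGroup X] [InnerProductSpace ℝ X]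
    [FiniteDimensional ℝ X] (A : X →ₗ[ℝ] X) {S : X →ₗ[ℝ] X} (hS : S.IsSymmetric) :
    LinearMap.trace ℝ X (((1 / 2 : ℝ) • (A + LinearMap.adjoint A)) ∘ₗ S) =
      LinearMap.trace ℝ X (A ∘ₗ S) := by
  rw [LinearMap.smul_comp, LinearMap.add_comp, map_smul, map_add, trace_adjoint_comp hS,
    smul_eq_mul]
  ring

theorem IsLocalMax.traceFunctional_nonneg (h : IsLocalMax E F c d B V U)
    (w : (∀ i, E i →L[ℝ] E i) × (∀ j, F j →L[ℝ] F j) × ℝ)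
    (hw : ∀ x ∈ Metric.sphere (0 : PiLp 2 E) 1,
      0 ≤ constraintFunctional E F c d B (Theta E F c d B V U) x w) :
    0 ≤ traceFunctional E F c d V U w := by
  have hw' : ∀ x, 0 ≤ constraintFunctional E F c d B (Theta E F c d B V U) x w := fun x => by
    rcases eq_or_ne x 0 with rfl | hx
    · simp [constraintFunctional_apply]
    · have h1 := hw (‖x‖⁻¹ • x) (by simp [norm_smul, hx])
      simp only [constraintFunctional_apply, map_smul, real_inner_smul_left,
        real_inner_smul_right] at h1 ⊢
      have h2 := mul_nonneg (sq_nonneg ‖x‖) h1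
      have hx' : ‖x‖ ≠ 0 := norm_ne_zero_iff.mpr hx
      field_simp at h2
      linarith
  have key := h.sum_trace_le (τ := w.2.2)
    (fun i => isSymmetric_symmetrization (w.1 i : E i →ₗ[ℝ] E i))
    (fun j => isSymmetric_symmetrization (w.2.1 j : F j →ₗ[ℝ] F j)) fun x => by
      have := hw' x
      rw [constraintFunctional_apply, inner_Theta] at this
      rw [inner_Theta]
      simpa only [inner_symmetrization_apply] using this
  simp only [trace_symmetrization_comp _ (h.1.1 _).isSymmetric_inverse,
    trace_symmetrization_comp _ (h.1.2.1 _).isSymmetric_inverse] at key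
  rw [traceFunctional_apply]
  linarith

theorem PosSemidef.sum_smul_rankOne {X : Type*} [NormedAddCommGroup X] [InnerProductSpace ℝ X]
    {n : ℕ} {a : Fin n → ℝ} (ha : ∀ l, 0 ≤ a l) (x : Fin n → X) :
    PosSemidef (∑ l, a l • (innerₛₗ ℝ (x l)).smulRight (x l)) := by
  refine ⟨fun y z => ?_, fun y => ?_⟩
  · simp only [LinearMap.sum_apply, LinearMap.smul_apply, LinearMap.smulRight_apply,
      innerₛₗ_apply_apply, sum_inner, inner_sum, real_inner_smul_left, real_inner_smul_right]
    refine Finset.sum_congr rfl fun l _ => ?_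
    rw [real_inner_comm (x l) y]
    ring
  · simp only [LinearMap.sum_apply, LinearMap.smul_apply, LinearMap.smulRight_apply,
      innerₛₗ_apply_apply, sum_inner, real_inner_smul_left]
    exact Finset.sum_nonneg fun l _ => mul_nonneg (ha l) (mul_self_nonneg _)

theorem inner_sum_smul_rankOne {X : Type*} [NormedAddCommGroup X] [InnerProductSpace ℝ X]
    {n : ℕ} (a : Fin n → ℝ) (x : Fin n → X) (y : X) :
    ⟪(∑ l, a l • (innerₛₗ ℝ (x l)).smulRight (x l)) y, y⟫ = ∑ l, a l * ⟪x l, y⟫ ^ 2 := by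
  simp only [LinearMap.sum_apply, LinearMap.smul_apply, LinearMap.smulRight_apply,
    innerₛₗ_apply_apply, sum_inner, real_inner_smul_left]
  exact Finset.sum_congr rfl fun l _ => by ring

theorem sum_apply_pi_single {ι : Type*} [Fintype ι] [DecidableEq ι] {X : ι → Type*}
    [∀ i, Zero (X i)] (i : ι) (A : X i) (g : ∀ i, X i → ℝ) (hg : ∀ i, g i 0 = 0) :
    ∑ i', g i' (Pi.single (M := X) i A i') = g i A := by
  rw [Finset.sum_eq_single i (fun i' _ hi => by rw [Pi.single_eq_of_ne hi, hg]) (by simp),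
    Pi.single_eq_same]

theorem IsLocalMax.exists_coupling (h : IsLocalMax E F c d B V U) (hc : ∀ i, 0 < c i)
    (hd : ∀ j, 0 < d j) :
    ∃ P ∈ Coupling E (fun i => Ring.inverse (V i)),
      (∀ j, Ring.inverse (U j) =
        (BLam E F c B j) ∘ₗ P ∘ₗ LinearMap.adjoint (BLam E F c B j)) ∧
      PosSemidef (Theta E F c d B V U) ∧ ∀ y, Theta E F c d B V U (P y) = 0 := by
  have hΘ := h.1.2.2
  obtain ⟨n, a, z, ha, hz, hψ⟩ := exists_nonneg_combination_of_isCompact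
    (isCompact_image_constraintFunctional (c := c) (d := d) (B := B) (Theta E F c d B V U))
    (w₀ := (fun i => (c i)⁻¹ • ContinuousLinearMap.id ℝ (E i), 0, 0))
    (ψ := traceFunctional E F c d V U) (by
      rintro _ ⟨x, hx, rfl⟩
      have hx : ‖x‖ = 1 := by simpa using hx
      rw [constraintFunctional_apply, inner_Theta]
      simp [real_inner_smul_left, (hc _).ne', projL_apply, ← PiLp.norm_sq_eq_of_L2, hx])
    fun w hw => h.traceFunctional_nonneg w fun x hx => hw _ ⟨x, hx, rfl⟩
  choose x _ hx using hz
  have key : ∀ w, traceFunctional E F c d V U w =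
      ∑ l, a l * constraintFunctional E F c d B (Theta E F c d B V U) (x l) w := fun w => by
    rw [hψ]
    simp [hx]
  simp only [traceFunctional_apply, constraintFunctional_apply] at key
  have hP := PosSemidef.sum_smul_rankOne ha x
  have hPq := inner_sum_smul_rankOne a x
  set P := ∑ l, a l • (innerₛₗ ℝ (x l)).smulRight (x l) with hPdef
  have hV : ∀ i v, ⟪Ring.inverse (V i) v, v⟫ = ∑ l, a l * ⟪v, projL E i (x l)⟫ ^ 2 := fun i v => by
    have := key (Pi.single i (LinearMap.toContinuousLinearMap ((innerₛₗ ℝ v).smulRight v)), 0, 0)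
    have h1 := sum_apply_pi_single i (LinearMap.toContinuousLinearMap ((innerₛₗ ℝ v).smulRight v))
      (fun i (A : E i →L[ℝ] E i) =>
        c i * LinearMap.trace ℝ _ ((A : E i →ₗ[ℝ] E i) ∘ₗ Ring.inverse (V i)))
      (by simp)
    have h2 := fun y : PiLp 2 E => sum_apply_pi_single i
      (LinearMap.toContinuousLinearMap ((innerₛₗ ℝ v).smulRight v))
      (fun i (A : E i →L[ℝ] E i) => c i * ⟪A (projL E i y), projL E i y⟫) (by simp)
    simp only [inner_Theta, ContinuousLinearMap.coe_coe, h1, h2] at this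
    simp [trace_rankOne_comp, real_inner_smul_left, mul_left_comm _ (c i), ← Finset.mul_sum,
      (hc i).ne', ← pow_two] at this
    exact this
  have hU : ∀ j w, ⟪Ring.inverse (U j) w, w⟫ = ∑ l, a l * ⟪w, BLam E F c B j (x l)⟫ ^ 2 :=
    fun j w => by
    have := key (0, Pi.single j (LinearMap.toContinuousLinearMap ((innerₛₗ ℝ w).smulRight w)), 0)
    have h1 := sum_apply_pi_single j (LinearMap.toContinuousLinearMap ((innerₛₗ ℝ w).smulRight w))
      (fun j (A : F j →L[ℝ] F j) =>
        d j * LinearMap.trace ℝ _ ((A : F j →ₗ[ℝ] F j) ∘ₗ Ring.inverse (U j)))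
      (by simp)
    have h2 := fun y : PiLp 2 E => sum_apply_pi_single j
      (LinearMap.toContinuousLinearMap ((innerₛₗ ℝ w).smulRight w))
      (fun j (A : F j →L[ℝ] F j) => d j * ⟪A (BLam E F c B j y), BLam E F c B j y⟫) (by simp)
    simp only [inner_Theta, ContinuousLinearMap.coe_coe, h1, h2] at this
    simp [trace_rankOne_comp, real_inner_smul_left, mul_left_comm _ (d j), ← Finset.mul_sum,
      (hd j).ne', ← pow_two] at this
    exact this
  refine ⟨P, ⟨hP, fun i v => ?_⟩, fun j => ?_, hΘ, fun y => ?_⟩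
  · rw [hPq, hV]
    simp only [real_inner_comm (singleL E i v), inner_singleL]
  · have hsymm : ((BLam E F c B j) ∘ₗ P ∘ₗ LinearMap.adjoint (BLam E F c B j)).IsSymmetric :=
      fun y z => by
        simp only [LinearMap.comp_apply]
        rw [← LinearMap.adjoint_inner_right, hP.1, LinearMap.adjoint_inner_left]
    rw [← sub_eq_zero, ← ((h.1.2.1 j).isSymmetric_inverse.sub hsymm).inner_map_self_eq_zero]
    intro w
    rw [LinearMap.sub_apply, inner_sub_left, hU, LinearMap.comp_apply, LinearMap.comp_apply,
      ← LinearMap.adjoint_inner_right, hPq]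
    simp only [LinearMap.adjoint_inner_right, real_inner_comm w, sub_self]
  · have h0 := key (0, 0, 1)
    have hl : ∀ l, a l * ⟪Theta E F c d B V U (x l), x l⟫ = 0 := by
      have hz (y) : ⟪Theta E F c d B (fun _ => 0) (fun _ => 0) y, y⟫ = 0 := by simp [inner_Theta]
      simp [hz] at h0
      rw [eq_comm, Finset.sum_eq_zero_iff_of_nonneg fun l _ => mul_nonneg (ha l) (hΘ.2 _)] at h0
      exact fun l => h0 l (Finset.mem_univ l)
    simp only [hPdef, LinearMap.sum_apply, LinearMap.smul_apply, LinearMap.smulRight_apply,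
      map_sum, map_smul]
    refine Finset.sum_eq_zero fun l _ => ?_
    rcases mul_eq_zero.mp (hl l) with h | h
    · rw [h, zero_smul]
    · rw [hΘ.apply_eq_zero h, smul_zero, smul_zero]

end Structure

end FRBL

namespace FRBL

variable {k m : ℕ}
  (E : Fin k → Type*) (F : Fin m → Type*)
  [∀ i, NormedAddCommGroup (E i)] [∀ i, InnerProductSpace ℝ (E i)]
  [∀ i, FiniteDimensional ℝ (E i)]
  [∀ i, MeasurableSpace (E i)] [∀ i, BorelSpace (E i)]
  [∀ j, NormedAddCommGroup (F j)] [∀ j, InnerProductSpace ℝ (F j)]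
  [∀ j, FiniteDimensional ℝ (F j)]
  [∀ j, MeasurableSpace (F j)] [∀ j, BorelSpace (F j)]

/-- **Proposition (equivalent characterizations of gaussian extremizers).** -/
theorem extremizer_tfae
    (c : Fin k → ℝ) (d : Fin m → ℝ) (B : ∀ i j, E i →ₗ[ℝ] F j)
    (hc : ∀ i, 0 < c i) (hd : ∀ j, 0 < d j)
    (V : ∀ i, E i →ₗ[ℝ] E i) (U : ∀ j, F j →ₗ[ℝ] F j)
    (hV : ∀ i, PosDef (V i)) (hU : ∀ j, PosDef (U j)) :
    List.TFAE
      [ -- (i) global maximum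
        IsGlobalMax E F c d B V U,
        -- (ii) local maximum
        IsLocalMax E F c d B V U,
        -- (iii)
        ∃ P ∈ Coupling E (fun i => Ring.inverse (V i)),
          (∀ j, Ring.inverse (U j) =
            (BLam E F c B j) ∘ₗ P ∘ₗ LinearMap.adjoint (BLam E F c B j)) ∧
          PosSemidef (Theta E F c d B V U) ∧
          ∀ y : PiLp 2 E, Theta E F c d B V U (P y) = 0,
        -- (iv)
        ScalingCond E F c d ∧
        ∃ P ∈ Coupling E (fun i => Ring.inverse (V i)),
          (∀ j, Ring.inverse (U j) =
            (BLam E F c B j) ∘ₗ P ∘ₗ LinearMap.adjoint (BLam E F c B j)) ∧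
          PosSemidef (Theta E F c d B V U),
        -- (v)
        ScalingCond E F c d ∧
        ∃ P ∈ Coupling E (fun i => Ring.inverse (V i)),
          (∀ (j : Fin m) (w : F j),
            ⟪((BLam E F c B j) ∘ₗ P ∘ₗ LinearMap.adjoint (BLam E F c B j)) w, w⟫ ≤
              ⟪Ring.inverse (U j) w, w⟫) ∧
          PosSemidef (Theta E F c d B V U) ∧
          ∃ R : PiLp 2 E →ₗ[ℝ] PiLp 2 E,
            PosSemidef R ∧ R ∘ₗ R = P ∧ (R ∘ₗ Theta E F c d B V U) ∘ₗ R = 0 ] := by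
  tfae_have 1 → 2 := fun h => ⟨h.1, 1, one_pos, fun V' U' h' _ _ => h.2 V' U' h'⟩
  tfae_have 2 → 3 := fun h => h.exists_coupling hc hd
  tfae_have 3 → 4 := by
    rintro ⟨P, hP, hUP, hΘ, hker⟩
    refine ⟨?_, P, hP, hUP, hΘ⟩
    obtain ⟨R, hR, rfl⟩ := hP.1.exists_sqrt
    refine (scalingCond_of_trace_eq_zero hV hU hR.1 hP hUP).mp ?_
    have h0 : Theta E F c d B V U ∘ₗ (R ∘ₗ R) = 0 := LinearMap.ext hker
    rw [LinearMap.comp_assoc, LinearMap.trace_comp_comm', LinearMap.comp_assoc, h0, map_zero]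
  tfae_have 4 → 1 := fun ⟨hscal, P, hP, hUP, hΘ⟩ =>
    isGlobalMax_of_coupling hd hV hU hscal hP hUP hΘ
  tfae_have 4 → 5 := by
    rintro ⟨hscal, P, hP, hUP, hΘ⟩
    refine ⟨hscal, P, hP, fun j w => by rw [hUP], hΘ, ?_⟩
    obtain ⟨R, hR, rfl⟩ := hP.1.exists_sqrt
    refine ⟨R, hR, rfl, PosSemidef.eq_zero_of_trace_eq_zero ⟨fun x y => ?_, fun x => ?_⟩
      ((scalingCond_of_trace_eq_zero hV hU hR.1 hP hUP).mpr hscal)⟩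
    · simp only [LinearMap.comp_apply]
      rw [hR.1, hΘ.1, hR.1]
    · simp only [LinearMap.comp_apply]
      rw [hR.1]
      exact hΘ.2 _
  tfae_have 5 → 4 := by
    rintro ⟨hscal, P, hP, hUP, hΘ, R, hR, rfl, hRΘ⟩
    exact ⟨hscal, R ∘ₗ R, hP, inverse_eq_of_inverse_ge hd hV hU hscal hR.1 hP hUP hRΘ, hΘ⟩
  tfae_finish

end FRBL
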